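/- Let A be an A∞-algebra over a commutative ring R. Equip A⊗A with the grading μ_{A⊗A}(b₁⊗b₂) := ‖b₁‖+‖b₂‖ and the operations: μ⊗_{r,s} := 0 whenever r > 0 and s > 0; μ⊗_{r,0}(a_1,…,a_r,b₁⊗b₂) := μ_{r+1}(a_1,…,a_r,b₁)⊗b₂ for r > 0; μ⊗_{0,s}(b₁⊗b₂,a_1,…,a_s) := (−1)^{‖b₁‖} b₁⊗μ_{s+1}(b₂,a_1,…,a_s) for s > 0; and μ⊗_{0,0}(b₁⊗b₂) := μ_1(b₁)⊗b₂ + (−1)^{‖b₁‖} b₁⊗μ_1(b₂). Then (A⊗A, (μ⊗_{r,s})_{r,s≥0}) is an A∞-bimodule over A. -/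

import Mathlib

namespace AInfPaper

open Finset
open scoped TensorProduct

attribute [local instance 2000] AddCommGroup.toAddCommMonoid

/-- The sign `(-1)^k` for `k : ℤ`. -/
def sgn (k : ℤ) : ℤ := (-1) ^ k.natAbs

section

variable (R : Type) [CommRing R]

/-- `R`-multilinearity of an `n`-ary map between modules. -/
def IsMultilinear {A B : Type} [AddCommGroup A] [Module R A] [AddCommGroup B] [Module R B]
    {n : ℕ} (g : (Fin n → A) → B) : Prop :=
  (∀ (v : Fin n → A) (i : Fin n) (x y : A),
      g (Function.update v i (x + y)) = g (Function.update v i x) + g (Function.update v i y)) ∧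
  (∀ (v : Fin n → A) (i : Fin n) (c : R) (x : A),
      g (Function.update v i (c • x)) = c • g (Function.update v i x))

/-- `R`-linearity in every slot of a map `A^{⊗r} ⊗ M ⊗ A^{⊗s} → N`. -/
def IsTriMultilinear {A M N : Type} [AddCommGroup A] [Module R A] [AddCommGroup M] [Module R M]
    [AddCommGroup N] [Module R N] {r s : ℕ}
    (g : (Fin r → A) → M → (Fin s → A) → N) : Prop :=
  (∀ (x : Fin r → A) (m : M) (y : Fin s → A) (i : Fin r) (v w : A),
      g (Function.update x i (v + w)) m y
        = g (Function.update x i v) m y + g (Function.update x i w) m y) ∧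
  (∀ (x : Fin r → A) (m : M) (y : Fin s → A) (i : Fin r) (c : R) (v : A),
      g (Function.update x i (c • v)) m y = c • g (Function.update x i v) m y) ∧
  (∀ (x : Fin r → A) (m₁ m₂ : M) (y : Fin s → A), g x (m₁ + m₂) y = g x m₁ y + g x m₂ y) ∧
  (∀ (x : Fin r → A) (c : R) (m : M) (y : Fin s → A), g x (c • m) y = c • g x m y) ∧
  (∀ (x : Fin r → A) (m : M) (y : Fin s → A) (j : Fin s) (v w : A),
      g x m (Function.update y j (v + w))
        = g x m (Function.update y j v) + g x m (Function.update y j w)) ∧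
  (∀ (x : Fin r → A) (m : M) (y : Fin s → A) (j : Fin s) (c : R) (v : A),
      g x m (Function.update y j (c • v)) = c • g x m (Function.update y j v))

/-- The conditions making `(gr, μ)` an `A∞`-algebra structure on `A`:
multilinearity of the operations, gradedness (`deg μₙ = 2 − n`) and the `A∞`-equations
(on homogeneous elements, with the Koszul signs `(-1)^{✠₁^{i-1}}` computed from
the reduced degrees `‖a‖ = deg a − 1`). -/
def IsAInftyAlgebra {A : Type} [AddCommGroup A] [Module R A]
    (gr : ℤ → Submodule R A) (μ : (n : ℕ) → (Fin n → A) → A) : Prop :=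
  (∀ n : ℕ, IsMultilinear R (μ n)) ∧
  (∀ (n : ℕ) (d : Fin n → ℤ) (a : Fin n → A),
      (∀ i, a i ∈ gr (d i)) → μ n a ∈ gr ((∑ i, d i) + 2 - n)) ∧
  (∀ (r : ℕ), 1 ≤ r → ∀ (d : ℕ → ℤ) (a : ℕ → A), (∀ q, q < r → a q ∈ gr (d q)) →
    ∑ n₁ ∈ Finset.Icc 1 r, ∑ i ∈ Finset.range (r + 1 - n₁),
      sgn (∑ q ∈ Finset.range i, (d q - 1)) •
        μ (r + 1 - n₁) (fun j =>
          if (j : ℕ) < i then a (j : ℕ)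
          else if (j : ℕ) = i then μ n₁ (fun k => a (i + (k : ℕ)))
          else a ((j : ℕ) + n₁ - 1)) = 0)

/-- The conditions making `(grM, μM)` an `A∞`-bimodule over the `A∞`-algebra `(gr, μ)`:
multilinearity, gradedness (`deg μM_{r,s} = 1 − r − s`) and the defining equations of
type `(r,s)` evaluated on homogeneous elements `a_1, …, a_{r+s}` (stored as `a 0, …,
a (r+s-1)` of degrees `d 0, …`) and `m` of degree `dm`. -/
def IsAInftyBimodule {A M : Type} [AddCommGroup A] [Module R A] [AddCommGroup M] [Module R M]
    (gr : ℤ → Submodule R A) (μ : (n : ℕ) → (Fin n → A) → A)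
    (grM : ℤ → Submodule R M)
    (μM : (r s : ℕ) → (Fin r → A) → M → (Fin s → A) → M) : Prop :=
  (∀ r s : ℕ, IsTriMultilinear R (μM r s)) ∧
  (∀ (r s : ℕ) (dx : Fin r → ℤ) (dm : ℤ) (dy : Fin s → ℤ)
      (x : Fin r → A) (m : M) (y : Fin s → A),
      (∀ i, x i ∈ gr (dx i)) → m ∈ grM dm → (∀ j, y j ∈ gr (dy j)) →
      μM r s x m y ∈ grM ((∑ i, dx i) + dm + (∑ j, dy j) + 1 - r - s)) ∧
  (∀ (r s : ℕ) (d : ℕ → ℤ) (dm : ℤ) (a : ℕ → A) (m : M),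
      (∀ q, q < r + s → a q ∈ gr (d q)) → m ∈ grM dm →
      (∑ r₂ ∈ Finset.Icc 1 r, ∑ i ∈ Finset.range (r + 1 - r₂),
          sgn (∑ q ∈ Finset.range i, (d q - 1)) •
            μM (r + 1 - r₂) s
              (fun j => if (j : ℕ) < i then a (j : ℕ)
                else if (j : ℕ) = i then μ r₂ (fun k => a (i + (k : ℕ)))
                else a ((j : ℕ) + r₂ - 1))
              m (fun j => a (r + (j : ℕ))))
      + (∑ r₁ ∈ Finset.range (r + 1), ∑ s₁ ∈ Finset.range (s + 1),
          sgn (∑ q ∈ Finset.range r₁, (d q - 1)) •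
            μM r₁ s₁ (fun j => a (j : ℕ))
              (μM (r - r₁) (s - s₁) (fun j => a (r₁ + (j : ℕ))) m (fun j => a (r + (j : ℕ))))
              (fun j => a (r + (s - s₁) + (j : ℕ))))
      + (∑ s₂ ∈ Finset.Icc 1 s, ∑ i ∈ Finset.range (s + 1 - s₂),
          sgn ((∑ q ∈ Finset.range (r + i), (d q - 1)) + dm) •
            μM r (s + 1 - s₂) (fun k => a (k : ℕ)) m
              (fun k => if (k : ℕ) < i then a (r + (k : ℕ))
                else if (k : ℕ) = i then μ s₂ (fun t => a (r + i + (t : ℕ)))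
                else a (r + (k : ℕ) + s₂ - 1))) = 0)

/-- The conditions making a family `f = (f_{r,s})` a morphism of `A∞`-bimodules
`M → N` over `(gr, μ)` of degree `dg`. -/
def IsBimoduleMorphism {A M N : Type} [AddCommGroup A] [Module R A] [AddCommGroup M] [Module R M]
    [AddCommGroup N] [Module R N]
    (gr : ℤ → Submodule R A) (μ : (n : ℕ) → (Fin n → A) → A)
    (grM : ℤ → Submodule R M) (μM : (r s : ℕ) → (Fin r → A) → M → (Fin s → A) → M)
    (grN : ℤ → Submodule R N) (μN : (r s : ℕ) → (Fin r → A) → N → (Fin s → A) → N)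
    (dg : ℤ)
    (f : (r s : ℕ) → (Fin r → A) → M → (Fin s → A) → N) : Prop :=
  (∀ r s : ℕ, IsTriMultilinear R (f r s)) ∧
  (∀ (r s : ℕ) (dx : Fin r → ℤ) (dm : ℤ) (dy : Fin s → ℤ)
      (x : Fin r → A) (m : M) (y : Fin s → A),
      (∀ i, x i ∈ gr (dx i)) → m ∈ grM dm → (∀ j, y j ∈ gr (dy j)) →
      f r s x m y ∈ grN ((∑ i, dx i) + dm + (∑ j, dy j) + dg - r - s)) ∧
  (∀ (r s : ℕ) (d : ℕ → ℤ) (dm : ℤ) (a : ℕ → A) (m : M),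
      (∀ q, q < r + s → a q ∈ gr (d q)) → m ∈ grM dm →
      (∑ r₁ ∈ Finset.range (r + 1), ∑ s₁ ∈ Finset.range (s + 1),
          sgn (dg * ∑ q ∈ Finset.range r₁, (d q - 1)) •
            μN r₁ s₁ (fun j => a (j : ℕ))
              (f (r - r₁) (s - s₁) (fun j => a (r₁ + (j : ℕ))) m (fun j => a (r + (j : ℕ))))
              (fun j => a (r + (s - s₁) + (j : ℕ))))
      = (∑ r₂ ∈ Finset.Icc 1 r, ∑ i ∈ Finset.range (r + 1 - r₂),
          sgn ((∑ q ∈ Finset.range i, (d q - 1)) + dg) •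
            f (r + 1 - r₂) s
              (fun j => if (j : ℕ) < i then a (j : ℕ)
                else if (j : ℕ) = i then μ r₂ (fun k => a (i + (k : ℕ)))
                else a ((j : ℕ) + r₂ - 1))
              m (fun j => a (r + (j : ℕ))))
      + (∑ r₁ ∈ Finset.range (r + 1), ∑ s₁ ∈ Finset.range (s + 1),
          sgn ((∑ q ∈ Finset.range r₁, (d q - 1)) + dg) •
            f r₁ s₁ (fun j => a (j : ℕ))
              (μM (r - r₁) (s - s₁) (fun j => a (r₁ + (j : ℕ))) m (fun j => a (r + (j : ℕ))))
              (fun j => a (r + (s - s₁) + (j : ℕ))))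
      + (∑ s₂ ∈ Finset.Icc 1 s, ∑ i ∈ Finset.range (s + 1 - s₂),
          sgn ((∑ q ∈ Finset.range (r + i), (d q - 1)) + dm + dg) •
            f r (s + 1 - s₂) (fun k => a (k : ℕ)) m
              (fun k => if (k : ℕ) < i then a (r + (k : ℕ))
                else if (k : ℕ) = i then μ s₂ (fun t => a (r + i + (t : ℕ)))
                else a (r + (k : ℕ) + s₂ - 1))))

/-- Concatenation `(a_1,…,a_r, a₀, a_{r+1},…,a_{r+s})` of two blocks of elements
around a middle element. -/
def cat3 {A : Type} (r s : ℕ) (x : Fin r → A) (a₀ : A) (y : Fin s → A)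
    (k : Fin (r + 1 + s)) : A :=
  if h : (k : ℕ) < r then x ⟨k, h⟩
  else if h2 : (k : ℕ) = r then a₀
  else y ⟨(k : ℕ) - (r + 1), by have := k.isLt; omega⟩


/-- The `n`-th summand `M ⊗ A^{⊗n}` of the Hochschild chain complex. -/
abbrev HTens (A M : Type) [AddCommGroup A] [Module R A] [AddCommGroup M] [Module R M]
    (n : ℕ) : Type :=
  M ⊗[R] (PiTensorProduct R (fun _ : Fin n => A))

/-- The Hochschild chain module `CH_*(A;M) = ⊕ₙ M ⊗ A^{⊗n}`. -/
abbrev HChain (A M : Type) [AddCommGroup A] [Module R A] [AddCommGroup M] [Module R M] : Type :=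
  DirectSum ℕ (fun n => HTens R A M n)

/-- The elementary Hochschild chain `m ⊗ a_1 ⊗ ⋯ ⊗ a_n` (the `a`'s are `a 0, …, a (n-1)`). -/
noncomputable def hchElt {A M : Type} [AddCommGroup A] [Module R A] [AddCommGroup M] [Module R M]
    (n : ℕ) (m : M) (a : ℕ → A) : HChain R A M :=
  DirectSum.lof R ℕ (fun k => HTens R A M k) n
    (m ⊗ₜ[R] PiTensorProduct.tprod R (fun i : Fin n => a (i : ℕ)))

/-- The component `b_{i,l}` of the Hochschild differential, evaluated on the homogeneous
elementary chain `m ⊗ a_1 ⊗ ⋯ ⊗ a_n` where `m` has degree `dm` and `a_{q+1}` has degree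
`d q`.  Here `i ∈ {0,…,n}` and `l ∈ {1,…,n+1}` as in the paper; the result is an
elementary chain in `M ⊗ A^{⊗(n-l+1)}` with the appropriate Koszul sign. -/
noncomputable def bComp {A M : Type} [AddCommGroup A] [Module R A] [AddCommGroup M] [Module R M]
    (μ : (n : ℕ) → (Fin n → A) → A)
    (μM : (r s : ℕ) → (Fin r → A) → M → (Fin s → A) → M)
    (n i l : ℕ) (dm : ℤ) (d : ℕ → ℤ) (m : M) (a : ℕ → A) : HChain R A M :=
  if 1 ≤ l ∧ l ≤ n + 1 ∧ i ≤ n then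
    (if i = 0 then
      DirectSum.lof R ℕ (fun k => HTens R A M k) (n + 1 - l)
        ((μM 0 (l - 1) (fun k => a (k : ℕ)) m (fun k => a (k : ℕ))) ⊗ₜ[R]
          PiTensorProduct.tprod R (fun q : Fin (n + 1 - l) => a (l - 1 + (q : ℕ))))
    else if i + l ≤ n + 1 then
      sgn (dm + ∑ q ∈ Finset.range (i - 1), (d q - 1)) •
        DirectSum.lof R ℕ (fun k => HTens R A M k) (n + 1 - l)
          (m ⊗ₜ[R] PiTensorProduct.tprod R (fun j : Fin (n + 1 - l) =>
            if (j : ℕ) < i - 1 then a (j : ℕ)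
            else if (j : ℕ) = i - 1 then μ l (fun k => a (i - 1 + (k : ℕ)))
            else a ((j : ℕ) + l - 1)))
    else
      sgn ((dm + ∑ q ∈ Finset.range (i - 1), (d q - 1)) *
            (∑ q ∈ Finset.Ico (i - 1) n, (d q - 1))) •
        DirectSum.lof R ℕ (fun k => HTens R A M k) (n + 1 - l)
          ((μM (n - i + 1) (i + l - n - 2) (fun k => a (i - 1 + (k : ℕ))) m
              (fun k => a (k : ℕ))) ⊗ₜ[R]
            PiTensorProduct.tprod R (fun j : Fin (n + 1 - l) => a (l + i - n - 2 + (j : ℕ)))))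
  else 0

/-- `b` is the Hochschild differential of `(gr,μ,grM,μM)`: on every homogeneous elementary
chain it is given by the sum of the components `b_{i,l}`. -/
def IsHochschildB {A M : Type} [AddCommGroup A] [Module R A] [AddCommGroup M] [Module R M]
    (gr : ℤ → Submodule R A) (μ : (n : ℕ) → (Fin n → A) → A)
    (grM : ℤ → Submodule R M) (μM : (r s : ℕ) → (Fin r → A) → M → (Fin s → A) → M)
    (b : HChain R A M →ₗ[R] HChain R A M) : Prop :=
  ∀ (n : ℕ) (dm : ℤ) (d : ℕ → ℤ) (m : M) (a : ℕ → A),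
    m ∈ grM dm → (∀ q, q < n → a q ∈ gr (d q)) →
    b (hchElt R n m a)
      = ∑ l ∈ Finset.Icc 1 (n + 1), ∑ i ∈ Finset.range (n + 1),
          bComp R μ μM n i l dm d m a

/-- The degree-`j` part `CH_j(A;M)` of the Hochschild chain module: the span of the
homogeneous elementary chains `m ⊗ a_1 ⊗ ⋯ ⊗ a_n` of degree
`n − μ(m) − Σ μ(a_q) = −μ(m) − Σ ‖a_q‖ = j`. -/
noncomputable def hchDeg {A M : Type} [AddCommGroup A] [Module R A] [AddCommGroup M] [Module R M]
    (gr : ℤ → Submodule R A) (grM : ℤ → Submodule R M) (j : ℤ) :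
    Submodule R (HChain R A M) :=
  Submodule.span R {x | ∃ (n : ℕ) (dm : ℤ) (d : ℕ → ℤ) (m : M) (a : ℕ → A),
    m ∈ grM dm ∧ (∀ q, q < n → a q ∈ gr (d q)) ∧
    (-dm - ∑ q ∈ Finset.range n, (d q - 1)) = j ∧ x = hchElt R n m a}

/-- The length filtration `F_p CH_*(A;M) = ⊕_{n ≤ p} M ⊗ A^{⊗n}` (`= 0` for `p < 0`). -/
noncomputable def hchFilt {A M : Type} [AddCommGroup A] [Module R A] [AddCommGroup M] [Module R M]
    (p : ℤ) : Submodule R (HChain R A M) :=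
  ⨆ (n : ℕ) (_ : (n : ℤ) ≤ p), LinearMap.range (DirectSum.lof R ℕ (fun k => HTens R A M k) n)

/-- The length filtration indexed by `ℕ∞ = ℕ ∪ {∞}`, with `F_∞ = CH_*(A;M)`. -/
noncomputable def hchFiltE {A M : Type} [AddCommGroup A] [Module R A] [AddCommGroup M] [Module R M]
    (p : WithTop ℕ) : Submodule R (HChain R A M) :=
  ⨆ (n : ℕ) (_ : (n : WithTop ℕ) ≤ p), LinearMap.range (DirectSum.lof R ℕ (fun k => HTens R A M k) n)

/-- `b1` is the family of maps `b₁ : M ⊗ A^{⊗n} → M ⊗ A^{⊗n}` built from the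
operations with exactly one input (`μ₁` and `μM_{0,0}`). -/
def IsB1 {A M : Type} [AddCommGroup A] [Module R A] [AddCommGroup M] [Module R M]
    (gr : ℤ → Submodule R A) (μ : (n : ℕ) → (Fin n → A) → A)
    (grM : ℤ → Submodule R M) (μM : (r s : ℕ) → (Fin r → A) → M → (Fin s → A) → M)
    (b1 : (k : ℕ) → HTens R A M k →ₗ[R] HTens R A M k) : Prop :=
  ∀ (n : ℕ) (dm : ℤ) (d : ℕ → ℤ) (m : M) (a : ℕ → A),
    m ∈ grM dm → (∀ q, q < n → a q ∈ gr (d q)) →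
    DirectSum.lof R ℕ (fun k => HTens R A M k) n
        (b1 n (m ⊗ₜ[R] PiTensorProduct.tprod R (fun i : Fin n => a (i : ℕ))))
      = ∑ i ∈ Finset.range (n + 1), bComp R μ μM n i 1 dm d m a

/-- The formula for the Hochschild chain map `f_*` induced by a morphism of
`A∞`-bimodules `f = (f_{r,s}) : M → N` of degree `dg`, evaluated on a homogeneous
elementary chain. -/
noncomputable def fstarFormula {A M N : Type} [AddCommGroup A] [Module R A] [AddCommGroup M] [Module R M]
    [AddCommGroup N] [Module R N]
    (f : (r s : ℕ) → (Fin r → A) → M → (Fin s → A) → N) (dg : ℤ)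
    (n : ℕ) (dm : ℤ) (d : ℕ → ℤ) (m : M) (a : ℕ → A) : HChain R A N :=
  ∑ r ∈ Finset.range (n + 1), ∑ s ∈ Finset.range (n + 1 - r),
    sgn ((dm + ∑ q ∈ Finset.range (n - r), (d q - 1)) * (∑ q ∈ Finset.Ico (n - r) n, (d q - 1))
          + dg * (-dm - ∑ q ∈ Finset.range n, (d q - 1))) •
      DirectSum.lof R ℕ (fun k => HTens R A N k) (n - r - s)
        ((f r s (fun k => a (n - r + (k : ℕ))) m (fun k => a (k : ℕ))) ⊗ₜ[R]
          PiTensorProduct.tprod R (fun j : Fin (n - r - s) => a (s + (j : ℕ))))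

/-- `F` is the Hochschild chain map induced by `f`. -/
def IsFStar {A M N : Type} [AddCommGroup A] [Module R A] [AddCommGroup M] [Module R M]
    [AddCommGroup N] [Module R N]
    (gr : ℤ → Submodule R A) (grM : ℤ → Submodule R M)
    (f : (r s : ℕ) → (Fin r → A) → M → (Fin s → A) → N) (dg : ℤ)
    (F : HChain R A M →ₗ[R] HChain R A N) : Prop :=
  ∀ (n : ℕ) (dm : ℤ) (d : ℕ → ℤ) (m : M) (a : ℕ → A),
    m ∈ grM dm → (∀ q, q < n → a q ∈ gr (d q)) →
    F (hchElt R n m a) = fstarFormula R f dg n dm d m a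


/-- The degree-`j` part of the graded dual of a graded module: those functionals which
vanish on `grV i` for every `i ≠ j`. -/
def dualGrade {V : Type} [AddCommMonoid V] [Module R V]
    (grV : ℤ → Submodule R V) (j : ℤ) : Submodule R (Module.Dual R V) where
  carrier := {φ | ∀ i : ℤ, i ≠ j → ∀ v ∈ grV i, φ v = 0}
  add_mem' := by
    intro φ ψ hφ hψ i hi v hv
    simp [hφ i hi v hv, hψ i hi v hv]
  zero_mem' := by intro i hi v hv; simp
  smul_mem' := by
    intro c φ hφ i hi v hv
    simp [hφ i hi v hv]

/-- `μStar` is the family of structure maps of the dual `A∞`-bimodule `M^{-*}`: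
tri-multilinear maps which, on homogeneous elements, are given by Tradler's formula with
the sign `(-1)^{‡_{r,s}}`.  Here a functional of degree `k` in `M^{-*}` is one that
vanishes on `grM i` for `i ≠ -k`. -/
def IsDualOps {A M : Type} [AddCommGroup A] [Module R A] [AddCommGroup M] [Module R M]
    (gr : ℤ → Submodule R A) (grM : ℤ → Submodule R M)
    (μM : (r s : ℕ) → (Fin r → A) → M → (Fin s → A) → M)
    (μStar : (r s : ℕ) → (Fin r → A) → Module.Dual R M → (Fin s → A) → Module.Dual R M) :
    Prop :=
  (∀ r s : ℕ, IsTriMultilinear R (μStar r s)) ∧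
  (∀ (r s : ℕ) (dx : Fin r → ℤ) (k : ℤ) (dy : Fin s → ℤ) (dm : ℤ)
      (x : Fin r → A) (φ : Module.Dual R M) (y : Fin s → A) (m : M),
      (∀ i, x i ∈ gr (dx i)) → φ ∈ dualGrade R grM (-k) → (∀ j, y j ∈ gr (dy j)) →
      m ∈ grM dm →
      μStar r s x φ y m
        = sgn (((∑ i, dx i) - r) * (((∑ j, dy j) - s) + k + dm) + k + 1) •
            φ (μM s r y m x))

/-- The Hochschild cochain module `CH^*(A;P) = Πₙ Hom(A^{⊗n}, P)`, with `Hom(A^{⊗n},P)`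
realized as `n`-multilinear maps. -/
abbrev HCochain (A P : Type) [AddCommGroup A] [Module R A] [AddCommGroup P] [Module R P] :
    Type :=
  (n : ℕ) → MultilinearMap R (fun _ : Fin n => A) P

/-- The degree-`j` part `CH^j(A;P) = Πₙ Hom^{j-n}(A^{⊗n},P)` of the Hochschild cochain
module. -/
def ccDeg {A P : Type} [AddCommGroup A] [Module R A] [AddCommGroup P] [Module R P]
    (gr : ℤ → Submodule R A) (grP : ℤ → Submodule R P) (j : ℤ) :
    Submodule R (HCochain R A P) where
  carrier := {c | ∀ (n : ℕ) (dFin : Fin n → ℤ) (a : Fin n → A),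
      (∀ i, a i ∈ gr (dFin i)) → c n a ∈ grP ((∑ i, dFin i) + (j - n))}
  add_mem' := by
    intro c c' hc hc' n dFin a ha
    have h : (c + c') n a = c n a + c' n a := rfl
    rw [h]
    exact (grP _).add_mem (hc n dFin a ha) (hc' n dFin a ha)
  zero_mem' := by
    intro n dFin a ha
    have h : (0 : HCochain R A P) n a = 0 := rfl
    rw [h]
    exact (grP _).zero_mem
  smul_mem' := by
    intro t c hc n dFin a ha
    have h : (t • c) n a = t • c n a := rfl
    rw [h]
    exact (grP _).smul_mem t (hc n dFin a ha)

/-- `β` is the Hochschild codifferential on `CH^*(A;P)` for the coefficient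
`A∞`-bimodule `(grP, μP)`: its value on a cochain which is homogeneous of degree `j` is
given componentwise on homogeneous elements by the defining formula. -/
def IsCodiff {A P : Type} [AddCommGroup A] [Module R A] [AddCommGroup P] [Module R P]
    (gr : ℤ → Submodule R A) (μ : (n : ℕ) → (Fin n → A) → A)
    (grP : ℤ → Submodule R P)
    (μP : (r s : ℕ) → (Fin r → A) → P → (Fin s → A) → P)
    (β : HCochain R A P →ₗ[R] HCochain R A P) : Prop :=
  ∀ (c : HCochain R A P) (j : ℤ),
    (∀ (n : ℕ) (dFin : Fin n → ℤ) (a : Fin n → A), (∀ i, a i ∈ gr (dFin i)) →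
        c n a ∈ grP ((∑ i, dFin i) + (j - n))) →
    ∀ (L : ℕ) (d : ℕ → ℤ) (a : ℕ → A), (∀ q, q < L → a q ∈ gr (d q)) →
      β c L (fun i : Fin L => a (i : ℕ))
        = ∑ l ∈ Finset.range (L + 1),
            ((∑ i ∈ Finset.range (L - l),
                sgn (∑ q ∈ Finset.range i, (d q - 1)) •
                  c (L - l) (fun t : Fin (L - l) =>
                    if (t : ℕ) < i then a (t : ℕ)
                    else if (t : ℕ) = i then μ (l + 1) (fun k => a (i + (k : ℕ)))
                    else a ((t : ℕ) + l)))
              + ∑ i ∈ Finset.range (l + 1),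
                  sgn (j * ((∑ q ∈ Finset.range i, (d q - 1)) + 1) + 1) •
                    μP i (l - i) (fun k => a (k : ℕ))
                      (c (L - l) (fun k : Fin (L - l) => a (i + (k : ℕ))))
                      (fun k => a ((L - l) + i + (k : ℕ))))


/-- `Φ` is the duality map `φ : Hom(CH_*(A;M),R) → CH^*(A;M^{-*})`, characterized on
homogeneous elements by `(φ(g)(a_1,…,a_n))(m) = (-1)^{μ(m)·✠₁ⁿ} g(m ⊗ a_1 ⊗ ⋯ ⊗ a_n)`. -/
def IsPhi {A M : Type} [AddCommGroup A] [Module R A] [AddCommGroup M] [Module R M]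
    (gr : ℤ → Submodule R A) (grM : ℤ → Submodule R M)
    (Φ : Module.Dual R (HChain R A M) →ₗ[R] HCochain R A (Module.Dual R M)) : Prop :=
  ∀ (g : Module.Dual R (HChain R A M)) (n : ℕ) (dm : ℤ) (d : ℕ → ℤ) (m : M) (a : ℕ → A),
    m ∈ grM dm → (∀ q, q < n → a q ∈ gr (d q)) →
    Φ g n (fun i : Fin n => a (i : ℕ)) m
      = sgn (dm * ∑ q ∈ Finset.range n, (d q - 1)) • g (hchElt R n m a)

end

section Tagged

variable {A M : Type} [AddCommGroup A] [AddCommGroup M]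

/-- A degree-tagged element obtained by applying `μ_l` to tagged elements. -/
def tagMu (μ : (n : ℕ) → (Fin n → A) → A) (l : ℕ) (v : Fin l → ℤ × A) : ℤ × A :=
  ((∑ i, (v i).1) + 2 - l, μ l (fun i => (v i).2))

/-- Extension of a finite tagged tuple by zero. -/
def pad {k : ℕ} (w : Fin k → ℤ × A) : ℕ → ℤ × A :=
  fun q => if h : q < k then w ⟨q, h⟩ else (0, 0)

/-- The component `(β(f))_l` of the Hochschild codifferential with coefficients in the
`A∞`-bimodule `(M, μM)`, for a (degree-tagged) cochain `f` of arity `nf` and cochain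
degree `j`, evaluated on the tagged elements `v 0, …, v (nf+l-1)`. -/
def betaT (μ : (n : ℕ) → (Fin n → A) → A)
    (μM : (r s : ℕ) → (Fin r → A) → M → (Fin s → A) → M)
    (j : ℤ) (nf : ℕ) (f : (Fin nf → ℤ × A) → M) (l : ℕ) (v : ℕ → ℤ × A) : M :=
  (∑ i ∈ Finset.range nf,
      sgn (∑ q ∈ Finset.range i, ((v q).1 - 1)) •
        f (fun t => if (t : ℕ) < i then v (t : ℕ)
            else if (t : ℕ) = i then tagMu μ (l + 1) (fun k => v (i + (k : ℕ)))
            else v ((t : ℕ) + l)))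
  + ∑ i ∈ Finset.range (l + 1),
      sgn (j * ((∑ q ∈ Finset.range i, ((v q).1 - 1)) + 1) + 1) •
        μM i (l - i) (fun k => (v (k : ℕ)).2)
          (f (fun k => v (i + (k : ℕ))))
          (fun k => (v (nf + i + (k : ℕ))).2)

/-- The component `(β(f))_l` of the Hochschild codifferential of `CH^*(A)`, i.e. with
coefficients in `A[1]` (so `μ^{A[1]}_{i-1,l-i+1} = μ_{l+1}` and the second sign uses
`deg f − 1`), for a tagged cochain `f` of arity `nf` and `CH^*(A)`-degree `j`. -/
def betaShift (μ : (n : ℕ) → (Fin n → A) → A)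
    (j : ℤ) (nf : ℕ) (f : (Fin nf → ℤ × A) → A) (l : ℕ) (v : ℕ → ℤ × A) : A :=
  (∑ i ∈ Finset.range nf,
      sgn (∑ q ∈ Finset.range i, ((v q).1 - 1)) •
        f (fun t => if (t : ℕ) < i then v (t : ℕ)
            else if (t : ℕ) = i then tagMu μ (l + 1) (fun k => v (i + (k : ℕ)))
            else v ((t : ℕ) + l)))
  + ∑ i ∈ Finset.range (l + 1),
      sgn ((j - 1) * ((∑ q ∈ Finset.range i, ((v q).1 - 1)) + 1) + 1) •
        μ (l + 1) (fun t =>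
          if (t : ℕ) < i then (v (t : ℕ)).2
          else if (t : ℕ) = i then f (fun k => v (i + (k : ℕ)))
          else (v (nf + (t : ℕ) - 1)).2)

/-- The summand `f ∪_{k,j₁,j₂} g` of the Hochschild cup product of (tagged) cochains
`f ∈ Hom(A^{⊗m},A)` of degree `jf` and `g ∈ Hom(A^{⊗n},A)` of degree `jg`, evaluated on
the tagged elements `v 0, …, v (m+n+k-1)`, with the sign `(-1)^{℧_{j₁,j₂}}`. -/
def cupT (μ : (n : ℕ) → (Fin n → A) → A) (jf jg : ℤ) (m n : ℕ)
    (f : (Fin m → ℤ × A) → A) (g : (Fin n → ℤ × A) → A)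
    (k j₁ j₂ : ℕ) (v : ℕ → ℤ × A) : A :=
  sgn ((jf - 1) * (∑ q ∈ Finset.range (j₁ - 1), ((v q).1 - 1))
       + (jg - 1) * ((∑ q ∈ Finset.range (j₂ - 1), ((v q).1 - 1)) + jf)) •
    μ (k + 2) (fun t =>
      if (t : ℕ) < j₁ - 1 then (v (t : ℕ)).2
      else if (t : ℕ) = j₁ - 1 then f (fun k' => v (j₁ - 1 + (k' : ℕ)))
      else if (t : ℕ) < j₂ - m then (v ((t : ℕ) + m - 1)).2
      else if (t : ℕ) = j₂ - m then g (fun k' => v (j₂ - 1 + (k' : ℕ)))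
      else (v ((t : ℕ) + m + n - 2)).2)

/-- The component of arity `m+n+k` of the full cup product `f ∪ g`. -/
def cupComp (μ : (n : ℕ) → (Fin n → A) → A) (jf jg : ℤ) (m n : ℕ)
    (f : (Fin m → ℤ × A) → A) (g : (Fin n → ℤ × A) → A)
    (k : ℕ) (v : ℕ → ℤ × A) : A :=
  ∑ j₁ ∈ Finset.Icc 1 (n + k), ∑ j₂ ∈ Finset.Icc (j₁ + m) (m + k + 1),
    cupT μ jf jg m n f g k j₁ j₂ v

end Tagged

section Signs

/-- The Maltese sum `✠_i^j` of the tuple `m ⊗ a_1 ⊗ ⋯` (with `μ(m) = dm`, `μ(a_{q+1}) = d q`),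
where the lower index `i ≤ 0` means that the `m`-slot is included (contributing `μ(m)`),
and the `a`-entries contribute their reduced degrees. -/
def malZ (dm : ℤ) (d : ℕ → ℤ) (i j : ℤ) : ℤ :=
  (if i ≤ 0 then dm else 0) + ∑ q ∈ Finset.Ico (i - 1).toNat j.toNat, (d q - 1)

/-- The sign exponent `*_i = ✠_0^i · ✠_{i+1}^n` of a tuple `m ⊗ a_1 ⊗ ⋯ ⊗ a_n`. -/
def starZ (dm : ℤ) (d : ℕ → ℤ) (n : ℕ) (i : ℤ) : ℤ :=
  malZ dm d 0 i * malZ dm d (i + 1) (n : ℤ)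

/-- The degree of the `M`-slot of `b_{i,l}(m ⊗ a_1 ⊗ ⋯ ⊗ a_n)`. -/
def bDm (n i l : ℕ) (dm : ℤ) (d : ℕ → ℤ) : ℤ :=
  if i = 0 then dm + (∑ q ∈ Finset.range (l - 1), d q) + 2 - l
  else if i + l ≤ n + 1 then dm
  else dm + (∑ q ∈ Finset.Ico (i - 1) n, d q) + (∑ q ∈ Finset.range (i + l - n - 2), d q) + 2 - l

/-- The degrees of the `A`-entries of `b_{i,l}(m ⊗ a_1 ⊗ ⋯ ⊗ a_n)`. -/
def bD (n i l : ℕ) (d : ℕ → ℤ) : ℕ → ℤ := fun q =>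
  if i = 0 then d (q + l - 1)
  else if i + l ≤ n + 1 then
    (if q < i - 1 then d q
     else if q = i - 1 then (∑ k ∈ Finset.range l, d (i - 1 + k)) + 2 - l
     else d (q + l - 1))
  else d (l + i - n - 2 + q)

/-- The cup-product sign exponent `℧_{j₁,j₂}(f,g,a_1,…)` for cochains of degrees
`jf` and `jg`, computed from the degrees `e q` of the inputs `a_{q+1}`. -/
def mho (jf jg : ℤ) (j₁ j₂ : ℕ) (e : ℕ → ℤ) : ℤ :=
  (jf - 1) * (∑ q ∈ Finset.range (j₁ - 1), (e q - 1))
    + (jg - 1) * ((∑ q ∈ Finset.range (j₂ - 1), (e q - 1)) + jf)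

/-- The degrees of the sequence obtained from `a_1, a_2, …` (of degrees `e 0, e 1, …`)
by replacing `a_i, …, a_{i+l}` with `μ_{l+1}(a_i,…,a_{i+l})`. -/
def insD (e : ℕ → ℤ) (i l : ℕ) : ℕ → ℤ := fun q =>
  if q < i - 1 then e q
  else if q = i - 1 then (∑ k ∈ Finset.range (l + 1), e (i - 1 + k)) + 1 - l
  else e (q + l)

end Signs

theorem sgn_eq_ite (k : ℤ) : sgn k = if Even k then 1 else -1 := by
  unfold sgn
  split_ifs with h
  · exact (Int.natAbs_even.mpr h).neg_one_pow
  · exact (Nat.not_even_iff_odd.mp (fun h' => h (Int.natAbs_even.mp h'))).neg_one_pow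

theorem sgn_add (k l : ℤ) : sgn (k + l) = sgn k * sgn l := by
  simp only [sgn_eq_ite, Int.even_add]
  by_cases hk : Even k <;> by_cases hl : Even l <;> simp [hk, hl]

theorem sgn_mul_self (k : ℤ) : sgn k * sgn k = 1 := by
  rw [sgn_eq_ite]
  split_ifs <;> rfl

theorem sgn_zero : sgn 0 = 1 := rfl

theorem sgn_one : sgn 1 = -1 := rfl

/-- Append an element at the end of a finite tuple. -/
def snocTuple {A : Type} {r : ℕ} (x : Fin r → A) (b : A) : Fin (r + 1) → A :=
  fun k => if h : (k : ℕ) < r then x ⟨k, h⟩ else b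

theorem pred_val_lt {s : ℕ} (k : Fin (s + 1)) (h : ¬(k : ℕ) = 0) : (k : ℕ) - 1 < s := by
  have := k.isLt
  omega

/-- Prepend an element to a finite tuple. -/
def consTuple {A : Type} {s : ℕ} (b : A) (y : Fin s → A) : Fin (s + 1) → A :=
  fun k => if h : (k : ℕ) = 0 then b else y ⟨(k : ℕ) - 1, pred_val_lt k h⟩

theorem sum_snocTuple {r : ℕ} (x : Fin r → ℤ) (b : ℤ) :
    ∑ k, snocTuple x b k = (∑ i, x i) + b := by
  rw [Fin.sum_univ_castSucc]
  simp [snocTuple]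

theorem sum_consTuple {s : ℕ} (b : ℤ) (y : Fin s → ℤ) :
    ∑ k, consTuple b y k = b + ∑ i, y i := by
  rw [Fin.sum_univ_succ]
  simp [consTuple]

theorem op_congr {A : Type} (μ : (n : ℕ) → (Fin n → A) → A) {n n' : ℕ} (hn : n = n')
    {f : Fin n → A} {f' : Fin n' → A}
    (h : ∀ (k : ℕ) (hk : k < n) (hk' : k < n'), f ⟨k, hk⟩ = f' ⟨k, hk'⟩) : μ n f = μ n' f' := by
  subst hn
  congr 1
  funext k
  exact h k k.2 k.2

section TriangularSums

variable {M : Type} [AddCommGroup M]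

theorem sum_Icc_one_succ_reflect (r : ℕ) (f : ℕ → M) :
    ∑ n ∈ Finset.Icc 1 (r + 1), f n = ∑ k ∈ Finset.range (r + 1), f (r - k + 1) := by
  refine Finset.sum_bij' (fun n _ => r + 1 - n) (fun k _ => r - k + 1) ?_ ?_ ?_ ?_ ?_
  · intro n hn; simp only [Finset.mem_Icc, Finset.mem_range] at *; omega
  · intro n hn; simp only [Finset.mem_Icc, Finset.mem_range] at *; omega
  · intro n hn; simp only [Finset.mem_Icc] at *; omega
  · intro n hn; simp only [Finset.mem_range] at *; omega
  · intro n hn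
    simp only [Finset.mem_Icc] at hn
    congr 1
    omega

theorem sum_Icc_one_succ_sum_range (r : ℕ) (f : ℕ → ℕ → M) :
    ∑ n ∈ Finset.Icc 1 (r + 1), ∑ i ∈ Finset.range (r + 1 - n), f n i
      = ∑ n ∈ Finset.Icc 1 r, ∑ i ∈ Finset.range (r + 1 - n), f n i := by
  rw [Finset.sum_Icc_succ_top (by omega)]
  simp

/-- Split the last column off a triangular sum. -/
theorem sum_triangle_last (r : ℕ) (f : ℕ → ℕ → M) :
    ∑ n ∈ Finset.Icc 1 (r + 1), ∑ i ∈ Finset.range (r + 1 + 1 - n), f n i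
      = (∑ n ∈ Finset.Icc 1 r, ∑ i ∈ Finset.range (r + 1 - n), f n i)
        + ∑ k ∈ Finset.range (r + 1), f (r - k + 1) k := by
  rw [← sum_Icc_one_succ_sum_range r f]
  have h : ∑ k ∈ Finset.range (r + 1), f (r - k + 1) k
      = ∑ n ∈ Finset.Icc 1 (r + 1), f n (r + 1 - n) := by
    rw [sum_Icc_one_succ_reflect r (fun n => f n (r + 1 - n))]
    refine Finset.sum_congr rfl fun k hk => ?_
    rw [Finset.mem_range] at hk
    congr 1
    omega
  rw [h, ← Finset.sum_add_distrib]
  refine Finset.sum_congr rfl fun n hn => ?_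
  rw [Finset.mem_Icc] at hn
  rw [show r + 1 + 1 - n = (r + 1 - n) + 1 by omega, Finset.sum_range_succ]

/-- Split the first column off a triangular sum. -/
theorem sum_triangle_first (r : ℕ) (f : ℕ → ℕ → M) :
    ∑ n ∈ Finset.Icc 1 (r + 1), ∑ i ∈ Finset.range (r + 1 + 1 - n), f n i
      = (∑ n ∈ Finset.Icc 1 r, ∑ i ∈ Finset.range (r + 1 - n), f n (i + 1))
        + ∑ k ∈ Finset.range (r + 1), f (r - k + 1) 0 := by
  rw [← sum_Icc_one_succ_sum_range r (fun n i => f n (i + 1)),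
    ← sum_Icc_one_succ_reflect r (fun n => f n 0), ← Finset.sum_add_distrib]
  refine Finset.sum_congr rfl fun n hn => ?_
  rw [Finset.mem_Icc] at hn
  rw [show r + 1 + 1 - n = (r + 1 - n) + 1 by omega, Finset.sum_range_succ']

/-- A sum over a rectangle of terms supported on the edges `s₁ = s`, `s₁ = 0` and
`r₁ = 0`, `r₁ = r`. -/
theorem sum_rectangle (r s : ℕ) (f₁ f₂ f₃ f₄ : ℕ → ℕ → M) :
    ∑ r₁ ∈ Finset.range (r + 1), ∑ s₁ ∈ Finset.range (s + 1),
        (((if s - s₁ = 0 then (if s₁ = 0 then f₁ r₁ s₁ else 0) else 0)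
          + (if s - s₁ = 0 then (if r₁ = 0 then f₂ r₁ s₁ else 0) else 0))
        + ((if r - r₁ = 0 then (if s₁ = 0 then f₃ r₁ s₁ else 0) else 0)
          + (if r - r₁ = 0 then (if r₁ = 0 then f₄ r₁ s₁ else 0) else 0)))
      = ((if s = 0 then ∑ r₁ ∈ Finset.range (r + 1), f₁ r₁ 0 else 0) + f₂ 0 s)
        + (f₃ r 0 + (if r = 0 then ∑ s₁ ∈ Finset.range (s + 1), f₄ 0 s₁ else 0)) := by
  have last (n : ℕ) (g : ℕ → M) :
      ∑ k ∈ Finset.range (n + 1), (if n - k = 0 then g k else 0) = g n := by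
    rw [Finset.sum_eq_single n]
    · simp
    · intro k hk hkn
      rw [Finset.mem_range] at hk
      rw [if_neg (by omega)]
    · simp
  have first (n : ℕ) (g : ℕ → M) :
      ∑ k ∈ Finset.range (n + 1), (if k = 0 then g k else 0) = g 0 := by
    simp
  have pull (p : Prop) [Decidable p] (g : ℕ → M) :
      ∑ k ∈ Finset.range (s + 1), (if p then g k else 0)
        = if p then ∑ k ∈ Finset.range (s + 1), g k else 0 := by
    split_ifs <;> simp
  have pull' (p : Prop) [Decidable p] (g : ℕ → M) :
      ∑ k ∈ Finset.range (r + 1), (if p then g k else 0)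
        = if p then ∑ k ∈ Finset.range (r + 1), g k else 0 := by
    split_ifs <;> simp
  simp only [Finset.sum_add_distrib, last, pull, pull', first]
  congr 2
  · by_cases h : s = 0
    · subst h; rfl
    · rw [if_neg h, if_neg h]
  · by_cases h : r = 0
    · subst h; rfl
    · rw [if_neg h, if_neg h]

end TriangularSums

section

variable {R : Type} [CommRing R] {A : Type} [AddCommGroup A] [Module R A]
  {gr : ℤ → Submodule R A} {μ : (n : ℕ) → (Fin n → A) → A}

theorem IsAInftyAlgebra.snoc_mem (hA : IsAInftyAlgebra R gr μ) {r : ℕ} {x : Fin r → A}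
    {dx : Fin r → ℤ} {b : A} {j : ℤ} (hx : ∀ i, x i ∈ gr (dx i)) (hb : b ∈ gr j) :
    μ (r + 1) (snocTuple x b) ∈ gr ((∑ i, dx i) + j + 1 - r) := by
  have h := hA.2.1 (r + 1) (snocTuple dx j) (snocTuple x b) (by
    intro k
    unfold snocTuple
    split_ifs with hk
    · exact hx _
    · exact hb)
  rw [sum_snocTuple] at h
  convert h using 2
  push_cast
  ring

theorem IsAInftyAlgebra.cons_mem (hA : IsAInftyAlgebra R gr μ) {s : ℕ} {y : Fin s → A}
    {dy : Fin s → ℤ} {b : A} {j : ℤ} (hb : b ∈ gr j) (hy : ∀ i, y i ∈ gr (dy i)) :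
    μ (s + 1) (consTuple b y) ∈ gr (j + (∑ i, dy i) + 1 - s) := by
  have h := hA.2.1 (s + 1) (consTuple j dy) (consTuple b y) (by
    intro k
    unfold consTuple
    split_ifs with hk
    · exact hb
    · exact hy _)
  rw [sum_consTuple] at h
  convert h using 2
  push_cast
  ring

/-- The `A∞`-equation for `(a_1,…,a_r,b)`, separating the terms whose inner operation
involves `b`. -/
theorem IsAInftyAlgebra.relation_snoc (hA : IsAInftyAlgebra R gr μ) (r : ℕ) (d : ℕ → ℤ)
    (a : ℕ → A) (ha : ∀ q, q < r → a q ∈ gr (d q)) {b : A} {j : ℤ} (hb : b ∈ gr j) :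
    (∑ r₂ ∈ Finset.Icc 1 r, ∑ i ∈ Finset.range (r + 1 - r₂),
        sgn (∑ q ∈ Finset.range i, (d q - 1)) •
          μ (r + 1 - r₂ + 1) (snocTuple
            (fun j => if (j : ℕ) < i then a (j : ℕ)
              else if (j : ℕ) = i then μ r₂ (fun k => a (i + (k : ℕ)))
              else a ((j : ℕ) + r₂ - 1)) b))
      + ∑ r₁ ∈ Finset.range (r + 1), sgn (∑ q ∈ Finset.range r₁, (d q - 1)) •
          μ (r₁ + 1) (snocTuple (fun j => a (j : ℕ))
            (μ (r - r₁ + 1) (snocTuple (fun j => a (r₁ + (j : ℕ))) b))) = 0 := by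
  have h := hA.2.2 (r + 1) (by omega) (fun q => if q < r then d q else j)
    (fun q => if q < r then a q else b) (by
      intro q _
      split_ifs with hq
      · exact ha q hq
      · exact hb)
  rw [sum_triangle_last] at h
  have hsgn (i : ℕ) (hi : i ≤ r) :
      ∑ q ∈ Finset.range i, ((if q < r then d q else j) - 1) = ∑ q ∈ Finset.range i, (d q - 1) := by
    refine Finset.sum_congr rfl fun q hq => ?_
    rw [Finset.mem_range] at hq
    rw [if_pos (by omega)]
  rw [← h]
  congr 1
  · refine Finset.sum_congr rfl fun n hn => Finset.sum_congr rfl fun i hi => ?_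
    rw [Finset.mem_Icc] at hn
    rw [Finset.mem_range] at hi
    rw [hsgn i (by omega)]
    congr 1
    refine op_congr μ (by omega) fun k hk hk' => ?_
    unfold snocTuple
    dsimp only
    by_cases hkr : k < r + 1 - n
    · rw [dif_pos hkr]
      by_cases h1 : k < i
      · rw [if_pos h1, if_pos h1, if_pos (by omega)]
      · rw [if_neg h1, if_neg h1]
        by_cases h2 : k = i
        · rw [if_pos h2, if_pos h2]
          refine op_congr μ rfl fun t ht _ => ?_
          rw [if_pos (by omega)]
        · rw [if_neg h2, if_neg h2, if_pos (by omega)]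
    · rw [dif_neg hkr, if_neg (by omega), if_neg (by omega), if_neg (by omega)]
  · refine Finset.sum_congr rfl fun i hi => ?_
    rw [Finset.mem_range] at hi
    rw [hsgn i (by omega)]
    congr 1
    refine op_congr μ (by omega) fun k hk hk' => ?_
    unfold snocTuple
    dsimp only
    by_cases h1 : k < i
    · rw [dif_pos h1, if_pos h1, if_pos (by omega)]
    · rw [dif_neg h1, if_neg h1, if_pos (by omega)]
      refine op_congr μ rfl fun t ht _ => ?_
      dsimp only
      by_cases h2 : t < r - i
      · rw [dif_pos h2, if_pos (by omega)]
      · rw [dif_neg h2, if_neg (by omega)]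

/-- The `A∞`-equation for `(b,a_1,…,a_s)`, separating the terms whose inner operation
involves `b`. -/
theorem IsAInftyAlgebra.relation_cons (hA : IsAInftyAlgebra R gr μ) (s : ℕ) (d : ℕ → ℤ)
    (a : ℕ → A) (ha : ∀ q, q < s → a q ∈ gr (d q)) {b : A} {j : ℤ} (hb : b ∈ gr j) :
    (∑ s₂ ∈ Finset.Icc 1 s, ∑ i ∈ Finset.range (s + 1 - s₂),
        sgn ((∑ q ∈ Finset.range i, (d q - 1)) + (j - 1)) •
          μ (s + 1 - s₂ + 1) (consTuple b
            (fun k => if (k : ℕ) < i then a (k : ℕ)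
              else if (k : ℕ) = i then μ s₂ (fun t => a (i + (t : ℕ)))
              else a ((k : ℕ) + s₂ - 1))))
      + ∑ s₁ ∈ Finset.range (s + 1),
          μ (s₁ + 1) (consTuple (μ (s - s₁ + 1) (consTuple b (fun j => a (j : ℕ))))
            (fun j => a (s - s₁ + (j : ℕ)))) = 0 := by
  have h := hA.2.2 (s + 1) (by omega) (fun q => if q = 0 then j else d (q - 1))
    (fun q => if q = 0 then b else a (q - 1)) (by
      intro q hq
      split_ifs with hq0
      · exact hb
      · exact ha _ (by omega))
  rw [sum_triangle_first] at h
  have hsgn (i : ℕ) :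
      ∑ q ∈ Finset.range (i + 1), ((if q = 0 then j else d (q - 1)) - 1)
        = (∑ q ∈ Finset.range i, (d q - 1)) + (j - 1) := by
    rw [Finset.sum_range_succ']
    simp
  rw [← h]
  congr 1
  · refine Finset.sum_congr rfl fun n hn => Finset.sum_congr rfl fun i hi => ?_
    rw [Finset.mem_Icc] at hn
    rw [Finset.mem_range] at hi
    rw [hsgn i]
    congr 1
    refine op_congr μ (by omega) fun k hk hk' => ?_
    unfold consTuple
    dsimp only
    by_cases hk0 : k = 0
    · rw [dif_pos hk0, if_pos (by omega), if_pos hk0]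
    · rw [dif_neg hk0]
      by_cases h1 : k < i + 1
      · rw [if_pos (by omega), if_pos h1, if_neg hk0]
      · rw [if_neg (by omega), if_neg h1]
        by_cases h2 : k = i + 1
        · rw [if_pos (by omega), if_pos h2]
          refine op_congr μ rfl fun t ht _ => ?_
          rw [if_neg (by omega)]
          congr 1
          omega
        · rw [if_neg (by omega), if_neg h2, if_neg (by omega)]
          congr 1
          omega
  · refine Finset.sum_congr rfl fun i hi => ?_
    rw [Finset.mem_range] at hi
    rw [Finset.range_zero, Finset.sum_empty, sgn_zero, one_smul]
    refine op_congr μ (by omega) fun k hk hk' => ?_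
    unfold consTuple
    dsimp only
    by_cases hk0 : k = 0
    · rw [dif_pos hk0, if_neg (by omega), if_pos hk0]
      refine op_congr μ rfl fun t ht _ => ?_
      dsimp only
      by_cases h2 : t = 0
      · rw [dif_pos h2, if_pos (by omega)]
      · rw [dif_neg h2, if_neg (by omega)]
        congr 1
        omega
    · rw [dif_neg hk0, if_neg (by omega), if_neg hk0, if_neg (by omega)]
      congr 1
      omega

theorem tensorOp_mem (hA : IsAInftyAlgebra R gr μ) {grT : ℤ → Submodule R (A ⊗[R] A)}
    (hgrT : ∀ j : ℤ, grT j = Submodule.span R {z | ∃ (j₁ j₂ : ℤ) (b₁ b₂ : A),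
        b₁ ∈ gr j₁ ∧ b₂ ∈ gr j₂ ∧ (j₁ - 1) + (j₂ - 1) = j ∧ z = b₁ ⊗ₜ[R] b₂})
    {μT : (r s : ℕ) → (Fin r → A) → A ⊗[R] A → (Fin s → A) → A ⊗[R] A}
    (hmult : ∀ r s : ℕ, IsTriMultilinear R (μT r s))
    (hT : ∀ (r s : ℕ) (j₁ : ℤ) (b₁ : A), b₁ ∈ gr j₁ →
        ∀ (b₂ : A) (x : Fin r → A) (y : Fin s → A),
        μT r s x (b₁ ⊗ₜ[R] b₂) y
          = (if s = 0 then μ (r + 1) (snocTuple x b₁) ⊗ₜ[R] b₂ else 0)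
            + (if r = 0 then sgn (j₁ - 1) • (b₁ ⊗ₜ[R] μ (s + 1) (consTuple b₂ y)) else 0))
    {r s : ℕ} {dx : Fin r → ℤ} {dm : ℤ} {dy : Fin s → ℤ} {x : Fin r → A} {m : A ⊗[R] A}
    {y : Fin s → A} (hx : ∀ i, x i ∈ gr (dx i)) (hm : m ∈ grT dm) (hy : ∀ j, y j ∈ gr (dy j)) :
    μT r s x m y ∈ grT ((∑ i, dx i) + dm + (∑ j, dy j) + 1 - r - s) := by
  obtain ⟨-, -, hadd, hsmul, -, -⟩ := hmult r s
  rw [hgrT dm] at hm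
  induction hm using Submodule.span_induction with
  | mem z hz =>
    obtain ⟨j₁, j₂, b₁, b₂, hb₁, hb₂, hj, rfl⟩ := hz
    rw [hT r s j₁ b₁ hb₁]
    refine add_mem ?_ ?_
    · split_ifs with hs
      · subst hs
        rw [hgrT]
        refine Submodule.subset_span ⟨_, _, _, _, hA.snoc_mem hx hb₁, hb₂, ?_, rfl⟩
        rw [← hj, Fin.sum_univ_zero dy]
        push_cast
        ring
      · exact zero_mem _
    · split_ifs with hr
      · subst hr
        rw [hgrT]
        apply zsmul_mem
        refine Submodule.subset_span ⟨_, _, _, _, hb₁, hA.cons_mem hb₂ hy, ?_, rfl⟩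
        rw [← hj, Fin.sum_univ_zero dx]
        push_cast
        ring
      · exact zero_mem _
  | zero =>
    have h0 := hsmul x 0 0 y
    rw [zero_smul, zero_smul] at h0
    rw [h0]
    exact zero_mem _
  | add z w _ _ hz hw =>
    rw [hadd]
    exact add_mem hz hw
  | smul c z _ hz =>
    rw [hsmul]
    exact Submodule.smul_mem _ c hz

theorem tensorOp_relation_tmul (hA : IsAInftyAlgebra R gr μ)
    {μT : (r s : ℕ) → (Fin r → A) → A ⊗[R] A → (Fin s → A) → A ⊗[R] A}
    (hmult : ∀ r s : ℕ, IsTriMultilinear R (μT r s))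
    (hT : ∀ (r s : ℕ) (j₁ : ℤ) (b₁ : A), b₁ ∈ gr j₁ →
        ∀ (b₂ : A) (x : Fin r → A) (y : Fin s → A),
        μT r s x (b₁ ⊗ₜ[R] b₂) y
          = (if s = 0 then μ (r + 1) (snocTuple x b₁) ⊗ₜ[R] b₂ else 0)
            + (if r = 0 then sgn (j₁ - 1) • (b₁ ⊗ₜ[R] μ (s + 1) (consTuple b₂ y)) else 0))
    (r s : ℕ) (d : ℕ → ℤ) (a : ℕ → A) (ha : ∀ q, q < r + s → a q ∈ gr (d q))
    {j₁ j₂ : ℤ} {b₁ b₂ : A} (hb₁ : b₁ ∈ gr j₁) (hb₂ : b₂ ∈ gr j₂) :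
    (∑ r₂ ∈ Finset.Icc 1 r, ∑ i ∈ Finset.range (r + 1 - r₂),
          sgn (∑ q ∈ Finset.range i, (d q - 1)) •
            μT (r + 1 - r₂) s
              (fun j => if (j : ℕ) < i then a (j : ℕ)
                else if (j : ℕ) = i then μ r₂ (fun k => a (i + (k : ℕ)))
                else a ((j : ℕ) + r₂ - 1))
              (b₁ ⊗ₜ[R] b₂) (fun j => a (r + (j : ℕ))))
      + (∑ r₁ ∈ Finset.range (r + 1), ∑ s₁ ∈ Finset.range (s + 1),
          sgn (∑ q ∈ Finset.range r₁, (d q - 1)) •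
            μT r₁ s₁ (fun j => a (j : ℕ))
              (μT (r - r₁) (s - s₁) (fun j => a (r₁ + (j : ℕ))) (b₁ ⊗ₜ[R] b₂)
                (fun j => a (r + (j : ℕ))))
              (fun j => a (r + (s - s₁) + (j : ℕ))))
      + (∑ s₂ ∈ Finset.Icc 1 s, ∑ i ∈ Finset.range (s + 1 - s₂),
          sgn ((∑ q ∈ Finset.range (r + i), (d q - 1)) + ((j₁ - 1) + (j₂ - 1))) •
            μT r (s + 1 - s₂) (fun k => a (k : ℕ)) (b₁ ⊗ₜ[R] b₂)
              (fun k => if (k : ℕ) < i then a (r + (k : ℕ))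
                else if (k : ℕ) = i then μ s₂ (fun t => a (r + i + (t : ℕ)))
                else a (r + (k : ℕ) + s₂ - 1))) = 0 := by
  have hadd (r s : ℕ) (x : Fin r → A) (z w : A ⊗[R] A) (y : Fin s → A) :
      μT r s x (z + w) y = μT r s x z y + μT r s x w y := (hmult r s).2.2.1 x z w y
  have hzero (r s : ℕ) (x : Fin r → A) (y : Fin s → A) : μT r s x 0 y = 0 := by
    simpa using (hmult r s).2.2.2.1 x 0 0 y
  have hzsmul (r s : ℕ) (x : Fin r → A) (c : ℤ) (z : A ⊗[R] A) (y : Fin s → A) :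
      μT r s x (c • z) y = c • μT r s x z y :=
    map_zsmul (AddMonoidHom.mk' (fun z => μT r s x z y) (fun z w => hadd r s x z w y)) c z
  have hite (r s : ℕ) (x : Fin r → A) (p : Prop) [Decidable p] (z : A ⊗[R] A) (y : Fin s → A) :
      μT r s x (if p then z else 0) y = if p then μT r s x z y else 0 := by
    split_ifs
    · rfl
    · exact hzero r s x y
  have hmid : (∑ r₁ ∈ Finset.range (r + 1), ∑ s₁ ∈ Finset.range (s + 1),
      sgn (∑ q ∈ Finset.range r₁, (d q - 1)) •
        μT r₁ s₁ (fun j => a (j : ℕ))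
          (μT (r - r₁) (s - s₁) (fun j => a (r₁ + (j : ℕ))) (b₁ ⊗ₜ[R] b₂)
            (fun j => a (r + (j : ℕ))))
          (fun j => a (r + (s - s₁) + (j : ℕ))))
      = (if s = 0 then ∑ r₁ ∈ Finset.range (r + 1),
            sgn (∑ q ∈ Finset.range r₁, (d q - 1)) •
              (μ (r₁ + 1) (snocTuple (fun j => a (j : ℕ))
                (μ (r - r₁ + 1) (snocTuple (fun j => a (r₁ + (j : ℕ))) b₁))) ⊗ₜ[R] b₂) else 0)
        + (if r = 0 then ∑ s₁ ∈ Finset.range (s + 1),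
              b₁ ⊗ₜ[R] μ (s₁ + 1) (consTuple
                (μ (s - s₁ + 1) (consTuple b₂ (fun j => a (r + (j : ℕ)))))
                (fun j => a (r + (s - s₁) + (j : ℕ)))) else 0) := by
    set e : ℕ → ℤ := fun r₁ => (∑ i : Fin (r - r₁), d (r₁ + (i : ℕ))) + j₁ + 1 - ((r - r₁ : ℕ) : ℤ)
      with he
    have hU (r₁ : ℕ) (hr₁ : r₁ ≤ r) :
        μ (r - r₁ + 1) (snocTuple (fun j => a (r₁ + (j : ℕ))) b₁) ∈ gr (e r₁) :=
      hA.snoc_mem (fun i => ha _ (by have := i.2; omega)) hb₁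
    have key := sum_rectangle r s
      (fun r₁ _ => sgn (∑ q ∈ Finset.range r₁, (d q - 1)) •
        (μ (r₁ + 1) (snocTuple (fun j => a (j : ℕ))
          (μ (r - r₁ + 1) (snocTuple (fun j => a (r₁ + (j : ℕ))) b₁))) ⊗ₜ[R] b₂))
      (fun r₁ s₁ => sgn (∑ q ∈ Finset.range r₁, (d q - 1)) • sgn (e r₁ - 1) •
        (μ (r - r₁ + 1) (snocTuple (fun j => a (r₁ + (j : ℕ))) b₁) ⊗ₜ[R]
          μ (s₁ + 1) (consTuple b₂ (fun j => a (r + (s - s₁) + (j : ℕ))))))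
      (fun r₁ s₁ => sgn (∑ q ∈ Finset.range r₁, (d q - 1)) • sgn (j₁ - 1) •
        (μ (r₁ + 1) (snocTuple (fun j => a (j : ℕ)) b₁) ⊗ₜ[R]
          μ (s - s₁ + 1) (consTuple b₂ (fun j => a (r + (j : ℕ))))))
      (fun r₁ s₁ => sgn (∑ q ∈ Finset.range r₁, (d q - 1)) • sgn (j₁ - 1) • sgn (j₁ - 1) •
        (b₁ ⊗ₜ[R] μ (s₁ + 1) (consTuple
          (μ (s - s₁ + 1) (consTuple b₂ (fun j => a (r + (j : ℕ)))))
          (fun j => a (r + (s - s₁) + (j : ℕ))))))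
    refine Eq.trans (Finset.sum_congr rfl fun r₁ hr₁ => Finset.sum_congr rfl fun s₁ _ => ?_)
      (key.trans ?_)
    · rw [Finset.mem_range] at hr₁
      rw [hT (r - r₁) (s - s₁) j₁ b₁ hb₁, hadd, hite, hite, hzsmul,
        hT r₁ s₁ (e r₁) _ (hU r₁ (by omega)), hT r₁ s₁ j₁ b₁ hb₁]
      simp only [smul_add, smul_ite, smul_zero, ite_add_zero]
    · have hcancel : sgn (e 0 - 1)
          = -(sgn (∑ q ∈ Finset.range r, (d q - 1)) * sgn (j₁ - 1)) := by
        have hdeg : e 0 - 1 = (∑ q ∈ Finset.range r, (d q - 1)) + (j₁ - 1) + 1 := by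
          simp only [he, Nat.sub_zero, Nat.zero_add, Fin.sum_univ_eq_sum_range,
            Finset.sum_sub_distrib, Finset.sum_const, Finset.card_range, nsmul_eq_mul, mul_one]
          ring
        rw [hdeg, sgn_add, sgn_add, sgn_one]
        ring
      simp only [smul_smul, hcancel, sgn_mul_self, Finset.range_zero, Finset.sum_empty, sgn_zero,
        one_smul, Nat.sub_self, Nat.sub_zero, add_zero, zero_add, one_mul]
      rw [neg_smul]
      abel
  rw [hmid]
  have hleft : (∑ r₂ ∈ Finset.Icc 1 r, ∑ i ∈ Finset.range (r + 1 - r₂),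
      sgn (∑ q ∈ Finset.range i, (d q - 1)) •
        μT (r + 1 - r₂) s
          (fun j => if (j : ℕ) < i then a (j : ℕ)
            else if (j : ℕ) = i then μ r₂ (fun k => a (i + (k : ℕ)))
            else a ((j : ℕ) + r₂ - 1))
          (b₁ ⊗ₜ[R] b₂) (fun j => a (r + (j : ℕ))))
      + (if s = 0 then ∑ r₁ ∈ Finset.range (r + 1),
            sgn (∑ q ∈ Finset.range r₁, (d q - 1)) •
              (μ (r₁ + 1) (snocTuple (fun j => a (j : ℕ))
                (μ (r - r₁ + 1) (snocTuple (fun j => a (r₁ + (j : ℕ))) b₁))) ⊗ₜ[R] b₂) else 0)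
      = 0 := by
    by_cases hs : s = 0
    · rw [if_pos hs]
      have h := congrArg ((TensorProduct.mk R A A).flip b₂)
        (hA.relation_snoc r d a (fun q hq => ha q (by omega)) hb₁)
      simp only [map_add, map_sum, map_zsmul, map_zero, LinearMap.flip_apply,
        TensorProduct.mk_apply] at h
      rw [← h]
      congr 1
      refine Finset.sum_congr rfl fun r₂ hr₂ => Finset.sum_congr rfl fun i _ => ?_
      rw [Finset.mem_Icc] at hr₂
      rw [hT _ _ j₁ b₁ hb₁, if_pos hs, if_neg (by omega), add_zero]
    · rw [if_neg hs, add_zero]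
      refine Finset.sum_eq_zero fun r₂ hr₂ => Finset.sum_eq_zero fun i _ => ?_
      rw [Finset.mem_Icc] at hr₂
      rw [hT _ _ j₁ b₁ hb₁, if_neg hs, if_neg (by omega), add_zero, smul_zero]
  have hright : (if r = 0 then ∑ s₁ ∈ Finset.range (s + 1),
              b₁ ⊗ₜ[R] μ (s₁ + 1) (consTuple
                (μ (s - s₁ + 1) (consTuple b₂ (fun j => a (r + (j : ℕ)))))
                (fun j => a (r + (s - s₁) + (j : ℕ)))) else 0)
      + (∑ s₂ ∈ Finset.Icc 1 s, ∑ i ∈ Finset.range (s + 1 - s₂),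
          sgn ((∑ q ∈ Finset.range (r + i), (d q - 1)) + ((j₁ - 1) + (j₂ - 1))) •
            μT r (s + 1 - s₂) (fun k => a (k : ℕ)) (b₁ ⊗ₜ[R] b₂)
              (fun k => if (k : ℕ) < i then a (r + (k : ℕ))
                else if (k : ℕ) = i then μ s₂ (fun t => a (r + i + (t : ℕ)))
                else a (r + (k : ℕ) + s₂ - 1))) = 0 := by
    by_cases hr : r = 0
    · subst hr
      rw [if_pos rfl]
      have h := congrArg (TensorProduct.mk R A A b₁)
        (hA.relation_cons s d a (fun q hq => ha q (by omega)) hb₂)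
      simp only [map_add, map_sum, map_zsmul, map_zero, TensorProduct.mk_apply] at h
      rw [← h, add_comm]
      simp only [zero_add]
      congr 1
      refine Finset.sum_congr rfl fun s₂ hs₂ => Finset.sum_congr rfl fun i _ => ?_
      rw [Finset.mem_Icc] at hs₂
      rw [hT _ _ j₁ b₁ hb₁, if_pos rfl, if_neg (by omega), zero_add, smul_smul]
      congr 1
      simp only [sgn_add]
      linear_combination (sgn (∑ q ∈ Finset.range i, (d q - 1)) * sgn (j₂ - 1))
        * sgn_mul_self (j₁ - 1)
    · rw [if_neg hr, zero_add]
      refine Finset.sum_eq_zero fun s₂ hs₂ => Finset.sum_eq_zero fun i _ => ?_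
      rw [Finset.mem_Icc] at hs₂
      rw [hT _ _ j₁ b₁ hb₁, if_neg hr, if_neg (by omega), add_zero, smul_zero]
  rw [← add_assoc, hleft, zero_add, hright]

end

section

variable (R : Type) [CommRing R]

/-- Theorem 1.8 of the paper, after Abouzaid.  Let `A` be an
`A∞`-algebra over `R`.  Equip `A ⊗ A` with the grading by sums of reduced degrees
(`μ_{A⊗A}(b₁ ⊗ b₂) = ‖b₁‖ + ‖b₂‖`) and with the operations
`μ⊗_{r,s} = 0` for `r,s > 0`,
`μ⊗_{r,0}(a_1,…,a_r, b₁⊗b₂) = μ_{r+1}(a_1,…,a_r,b₁) ⊗ b₂` for `r > 0`,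
`μ⊗_{0,s}(b₁⊗b₂, a_1,…,a_s) = (-1)^{‖b₁‖} b₁ ⊗ μ_{s+1}(b₂,a_1,…,a_s)` for `s > 0`, and
`μ⊗_{0,0}(b₁⊗b₂) = μ₁(b₁) ⊗ b₂ + (-1)^{‖b₁‖} b₁ ⊗ μ₁(b₂)`.
Then `(A ⊗ A, (μ⊗_{r,s}))` is an `A∞`-bimodule over `A`. -/
theorem tensor_square_is_bimodule
    {A : Type} [AddCommGroup A] [Module R A]
    (gr : ℤ → Submodule R A) (μ : (n : ℕ) → (Fin n → A) → A)
    (hA : IsAInftyAlgebra R gr μ)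
    (grT : ℤ → Submodule R (A ⊗[R] A))
    (hgrT : ∀ j : ℤ, grT j = Submodule.span R {z | ∃ (j₁ j₂ : ℤ) (b₁ b₂ : A),
        b₁ ∈ gr j₁ ∧ b₂ ∈ gr j₂ ∧ (j₁ - 1) + (j₂ - 1) = j ∧ z = b₁ ⊗ₜ[R] b₂})
    (μT : (r s : ℕ) → (Fin r → A) → A ⊗[R] A → (Fin s → A) → A ⊗[R] A)
    (hmult : ∀ r s : ℕ, IsTriMultilinear R (μT r s))
    (hrs : ∀ (r s : ℕ), 0 < r → 0 < s → ∀ (x : Fin r → A) (z : A ⊗[R] A) (y : Fin s → A),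
        μT r s x z y = 0)
    (hr0 : ∀ (r : ℕ), 0 < r → ∀ (x : Fin r → A) (b₁ b₂ : A) (y : Fin 0 → A),
        μT r 0 x (b₁ ⊗ₜ[R] b₂) y
          = (μ (r + 1) (fun k => if h : (k : ℕ) < r then x ⟨k, h⟩ else b₁)) ⊗ₜ[R] b₂)
    (h0s : ∀ (s : ℕ), 0 < s → ∀ (j₁ : ℤ) (b₁ : A), b₁ ∈ gr j₁ →
        ∀ (b₂ : A) (x : Fin 0 → A) (y : Fin s → A),
        μT 0 s x (b₁ ⊗ₜ[R] b₂) y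
          = sgn (j₁ - 1) • (b₁ ⊗ₜ[R] μ (s + 1) (fun k : Fin (s + 1) =>
              if h : (k : ℕ) = 0 then b₂ else y ⟨(k : ℕ) - 1, by have := k.isLt; omega⟩)))
    (h00 : ∀ (j₁ : ℤ) (b₁ : A), b₁ ∈ gr j₁ → ∀ (b₂ : A) (x y : Fin 0 → A),
        μT 0 0 x (b₁ ⊗ₜ[R] b₂) y
          = (μ 1 (fun _ => b₁)) ⊗ₜ[R] b₂ + sgn (j₁ - 1) • (b₁ ⊗ₜ[R] μ 1 (fun _ => b₂))) :
    IsAInftyBimodule R gr μ grT μT := by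
  have hT (r s : ℕ) (j₁ : ℤ) (b₁ : A) (hb₁ : b₁ ∈ gr j₁) (b₂ : A) (x : Fin r → A)
      (y : Fin s → A) : μT r s x (b₁ ⊗ₜ[R] b₂) y
        = (if s = 0 then μ (r + 1) (snocTuple x b₁) ⊗ₜ[R] b₂ else 0)
          + (if r = 0 then sgn (j₁ - 1) • (b₁ ⊗ₜ[R] μ (s + 1) (consTuple b₂ y)) else 0) := by
    rcases Nat.eq_zero_or_pos r with hr | hr <;> rcases Nat.eq_zero_or_pos s with hs | hs
    · subst hr hs
      rw [if_pos rfl, if_pos rfl, h00 j₁ b₁ hb₁]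
      have hcons : consTuple b₂ y = fun _ => b₂ := funext fun k => dif_pos (by omega)
      rw [hcons]
      rfl
    · subst hr
      rw [if_neg hs.ne', if_pos rfl, zero_add, h0s s hs j₁ b₁ hb₁]
      rfl
    · subst hs
      rw [if_pos rfl, if_neg hr.ne', add_zero, hr0 r hr]
      rfl
    · rw [if_neg hs.ne', if_neg hr.ne', add_zero, hrs r s hr hs]
  refine ⟨hmult, fun r s dx dm dy x m y hx hm hy => tensorOp_mem hA hgrT hmult hT hx hm hy, ?_⟩
  intro r s d dm a m ha hm
  have hadd (r s : ℕ) (x : Fin r → A) (z w : A ⊗[R] A) (y : Fin s → A) :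
      μT r s x (z + w) y = μT r s x z y + μT r s x w y := (hmult r s).2.2.1 x z w y
  have hsmul (r s : ℕ) (x : Fin r → A) (c : R) (z : A ⊗[R] A) (y : Fin s → A) :
      μT r s x (c • z) y = c • μT r s x z y := (hmult r s).2.2.2.1 x c z y
  have hzero (r s : ℕ) (x : Fin r → A) (y : Fin s → A) : μT r s x 0 y = 0 := by
    simpa using hsmul r s x 0 0 y
  rw [hgrT dm] at hm
  induction hm using Submodule.span_induction with
  | mem z hz =>
    obtain ⟨j₁, j₂, b₁, b₂, hb₁, hb₂, rfl, rfl⟩ := hz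
    exact tensorOp_relation_tmul hA hmult hT r s d a ha hb₁ hb₂
  | zero => simp only [hzero, smul_zero, Finset.sum_const_zero, add_zero]
  | add z w _ _ hz hw =>
    have h := congrArg₂ (· + ·) hz hw
    simp only [add_zero] at h
    rw [← h]
    simp only [hadd, smul_add, Finset.sum_add_distrib]
    abel
  | smul c z _ hz =>
    have h := congrArg (c • ·) hz
    simp only [smul_zero, smul_add, Finset.smul_sum] at h
    rw [← h]
    simp only [hsmul, smul_comm c]

end

end AInfPaper
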